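/- Let p be a prime, h ≥ 2 an integer (so q = p^h is not prime), and let S be a finite set of vectors of 𝔽_q^k (k ≥ 1) with the property that every subset of S of size k is a basis of 𝔽_q^k. If q − 2p + 4 ≤ k ≤ q, then |S| ≤ q + 1. -/

import Mathlib

open Finset Polynomial

theorem FiniteField.prod_erase_sub_eq {F : Type*} [Field F] [Fintype F] [DecidableEq F] (a : F) :
    ∏ b ∈ univ.erase a, (a - b) = ∏ x ∈ univ.erase (0 : F), x := by
  refine Finset.prod_bij (fun b _ => a - b) ?_ ?_ ?_ ?_
  · intro b hb
    simp only [mem_erase, mem_univ, and_true] at hb ⊢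
    exact sub_ne_zero.2 (Ne.symm hb)
  · intro b _ c _ h
    simpa using h
  · intro x hx
    refine ⟨a - x, ?_, by simp⟩
    simpa using hx
  · intros; rfl

theorem sum_mul_prod_bracket_inv_eq_zero {F : Type*} [Field F] [Fintype F] [DecidableEq F]
    {ι : Type*} [DecidableEq ι] (β : ι → ι → F) (N E : Finset ι) (s₀ : ι)
    (hs₀ : s₀ ∈ N) (hE : E ⊆ N.erase s₀) (hcard : #N + #E = Fintype.card F + 3)
    (hE2 : 2 ≤ #E)
    (hne : ∀ s ∈ N, ∀ e ∈ N, s ≠ e → β s e ≠ 0)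
    (halt : ∀ s e, β s e = - β e s)
    (hpl : ∀ a b c d, β c d ≠ 0 → β a b * β c d - β a c * β b d + β a d * β b c = 0) :
    ∑ e ∈ E, (∏ s ∈ N.erase e, β s e)⁻¹ * (∏ u ∈ E.erase e, β u e)⁻¹ = 0 := by
  obtain ⟨e₂, he₂⟩ : E.Nonempty := card_pos.1 (by omega)
  have hmem : ∀ {s}, s ∈ N.erase s₀ → β s s₀ ≠ 0 := fun {s} hs =>
    hne s (mem_of_mem_erase hs) s₀ hs₀ (ne_of_mem_erase hs)
  have hκ : β s₀ e₂ ≠ 0 := by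
    rw [halt]; exact neg_ne_zero.2 (hmem (hE he₂))
  set P := N.erase s₀ with hP
  set κ := (β s₀ e₂)⁻¹ with hκdef
  set a : ι → F := fun s => β s e₂ / β s s₀ with ha
  have hβ : ∀ s ∈ P, ∀ e ∈ P, β s e = κ * β s s₀ * β e s₀ * (a e - a s) := by
    intro s hs e he
    have h := hpl s e s₀ e₂ hκ
    have h1 := hmem hs
    have h2 := hmem he
    simp only [ha, hκdef]
    field_simp
    linear_combination h
  have hainj : Set.InjOn a P := by
    intro s hs e he h
    by_contra hse
    refine hne s (mem_of_mem_erase hs) e (mem_of_mem_erase he) hse ?_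
    rw [hβ s hs e he, h]; simp
  have hPcard : #P + 1 = #N := by rw [hP]; exact card_erase_add_one hs₀
  have hEP : #E ≤ #P := card_le_card hE
  set W : Finset F := univ \ P.image a with hW
  have hWcard : #W + #P = Fintype.card F := by
    rw [hW, card_sdiff_of_subset (subset_univ _), card_image_of_injOn hainj, card_univ]
    have : #(P.image a) ≤ Fintype.card F := card_le_univ _
    rw [card_image_of_injOn hainj] at this
    omega
  set Q : F[X] := ∏ w ∈ W, (X - C w) with hQ
  have hQdeg : Q.natDegree = #W := by
    rw [hQ, natDegree_prod_of_monic _ _ (fun w _ => monic_X_sub_C w)]; simp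
  have hLag := Lagrange.coeff_eq_sum (s := E) (v := a) (P := Q)
    (hainj.mono (by exact_mod_cast hE))
    (lt_of_le_of_lt degree_le_natDegree (by rw [hQdeg]; exact_mod_cast (by omega)))
  rw [coeff_eq_zero_of_natDegree_lt (by omega)] at hLag
  set c := ∏ x ∈ univ.erase (0 : F), x with hc
  have hc0 : c ≠ 0 := prod_ne_zero_iff.2 fun x hx => ne_of_mem_erase hx
  set γP := ∏ s ∈ P, β s s₀ with hγP
  set γE := ∏ s ∈ E, β s s₀ with hγE
  have hterm : ∀ e ∈ E, (∏ s ∈ N.erase e, β s e)⁻¹ * (∏ u ∈ E.erase e, β u e)⁻¹ =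
      (-(γP * γE * κ ^ Fintype.card F * c))⁻¹ *
        (Q.eval (a e) / ∏ u ∈ E.erase e, (a e - a u)) := by
    intro e he
    have heP := hE he
    have hγe := hmem heP
    have hQe : (∏ s ∈ P.erase e, (a e - a s)) * Q.eval (a e) = c := by
      rw [hc, ← FiniteField.prod_erase_sub_eq (a e), hQ, eval_prod]
      simp only [eval_sub, eval_X, eval_C]
      have : (univ.erase (a e)) = (P.erase e).image a ∪ W := by
        ext x
        simp only [mem_erase, mem_univ, and_true, mem_union, mem_image, hW, mem_sdiff, true_and]
        constructor
        · intro hx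
          by_cases h : ∃ s ∈ P, a s = x
          · obtain ⟨s, hs, rfl⟩ := h
            exact Or.inl ⟨s, ⟨fun h => hx (by rw [h]), hs⟩, rfl⟩
          · exact Or.inr h
        · rintro (⟨s, ⟨hse, hs⟩, rfl⟩ | h) hx
          · exact hse (hainj hs heP hx)
          · exact h ⟨e, heP, hx.symm⟩
      rw [this, prod_union, prod_image (fun x hx y hy h =>
        hainj (mem_of_mem_erase hx) (mem_of_mem_erase hy) h)]
      rw [disjoint_left]
      intro x hx hxW
      obtain ⟨s, hs, rfl⟩ := mem_image.1 hx
      exact (mem_sdiff.1 hxW).2 (mem_image_of_mem a (mem_of_mem_erase hs))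
    have hX : ∏ s ∈ N.erase e, β s e =
        -(γP * κ ^ (#P - 1) * (β e s₀) ^ (#P - 1) * ∏ s ∈ P.erase e, (a e - a s)) := by
      have hs₀e : s₀ ∈ N.erase e := mem_erase.2 ⟨fun h => (ne_of_mem_erase heP) h.symm, hs₀⟩
      rw [← mul_prod_erase _ _ hs₀e, erase_right_comm, ← hP,
        prod_congr rfl fun s hs => hβ s (mem_of_mem_erase hs) e heP, prod_mul_distrib,
        prod_mul_distrib, prod_mul_distrib, prod_const, prod_const, card_erase_of_mem heP,
        hγP, ← mul_prod_erase _ _ heP, halt s₀ e]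
      ring
    have hY : β e s₀ * ∏ u ∈ E.erase e, β u e =
        γE * κ ^ (#E - 1) * (β e s₀) ^ (#E - 1) * ∏ s ∈ E.erase e, (a e - a s) := by
      rw [prod_congr rfl fun s hs => hβ s (hE (mem_of_mem_erase hs)) e heP, prod_mul_distrib,
        prod_mul_distrib, prod_mul_distrib, prod_const, prod_const, card_erase_of_mem he,
        hγE, ← mul_prod_erase _ _ he]
      ring
    have hpow : (β e s₀) ^ (#P - 1) * (β e s₀) ^ (#E - 1) = β e s₀ := by
      rw [← pow_add, show #P - 1 + (#E - 1) = Fintype.card F by omega, FiniteField.pow_card]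
    have hpowκ : κ ^ (#P - 1) * κ ^ (#E - 1) = κ ^ Fintype.card F := by
      rw [← pow_add, show #P - 1 + (#E - 1) = Fintype.card F by omega]
    have hXY : (∏ s ∈ N.erase e, β s e) * ∏ u ∈ E.erase e, β u e =
        -(γP * γE * κ ^ Fintype.card F) *
          ((∏ s ∈ P.erase e, (a e - a s)) * ∏ s ∈ E.erase e, (a e - a s)) := by
      apply mul_left_cancel₀ hγe
      rw [mul_left_comm, hY, hX, ← hpowκ]
      linear_combination -(γP * γE * (κ ^ (#P - 1) * κ ^ (#E - 1)) *
        ((∏ s ∈ P.erase e, (a e - a s)) * ∏ s ∈ E.erase e, (a e - a s))) * hpow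
    have hQ0 : Q.eval (a e) ≠ 0 := fun h => hc0 (by rw [← hQe, h, mul_zero])
    rw [← mul_inv, hXY, ← hQe, div_eq_mul_inv]
    simp only [mul_inv, neg_mul, inv_neg]
    linear_combination -(γP⁻¹ * γE⁻¹ * (κ ^ Fintype.card F)⁻¹ *
      (∏ s ∈ P.erase e, (a e - a s))⁻¹ * (∏ s ∈ E.erase e, (a e - a s))⁻¹) * -inv_mul_cancel₀ hQ0
  rw [sum_congr rfl hterm, ← mul_sum, ← hLag, mul_zero]

theorem sum_filter_subset_eq_zero {F ι : Type*} [Field F] [DecidableEq ι] (p : ℕ) [CharP F p]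
    (g : Finset ι → F) (E : Finset ι) (d : ℕ)
    (hg : ∀ A ⊆ E, #A + 1 = d → ∑ e ∈ E \ A, g (insert e A) = 0)
    (A : Finset ι) (hA : A ⊆ E) (hAd : #A < d) (hAp : d < #A + p) :
    ∑ C ∈ powersetCard d E with A ⊆ C, g C = 0 := by
  induction hn : d - #A generalizing A with
  | zero => omega
  | succ n ih =>
    have hcount : ((d - #A : ℕ) : F) * ∑ C ∈ powersetCard d E with A ⊆ C, g C =
        ∑ e ∈ E \ A, ∑ C ∈ powersetCard d E with insert e A ⊆ C, g C := by
      simp_rw [sum_filter]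
      rw [sum_comm, mul_sum]
      refine sum_congr rfl fun C hC => ?_
      obtain ⟨hCE, hCd⟩ := mem_powersetCard.1 hC
      rw [← sum_filter, sum_const, nsmul_eq_mul]
      split_ifs with hAC
      · have : ({e ∈ E \ A | insert e A ⊆ C} : Finset ι) = C \ A := by
          ext e
          simp only [mem_filter, mem_sdiff, insert_subset_iff]
          exact ⟨fun h => ⟨h.2.1, h.1.2⟩, fun h => ⟨⟨hCE h.1, h.2⟩, h.1, hAC⟩⟩
        rw [this, card_sdiff_of_subset hAC, hCd]
      · rw [filter_false_of_mem fun e _ h => hAC ((subset_insert e A).trans h)]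
        simp
    have hne : ((d - #A : ℕ) : F) ≠ 0 := by
      rw [Ne, CharP.cast_eq_zero_iff F p]
      exact Nat.not_dvd_of_pos_of_lt (by omega) (by omega)
    refine (mul_eq_zero.1 (hcount.trans ?_)).resolve_left hne
    by_cases h1 : #A + 1 = d
    · rw [← hg A hA h1]
      refine sum_congr rfl fun e he => ?_
      obtain ⟨heE, heA⟩ := mem_sdiff.1 he
      have : ({C ∈ powersetCard d E | insert e A ⊆ C} : Finset (Finset ι)) = {insert e A} := by
        ext C
        simp only [mem_filter, mem_powersetCard, mem_singleton]
        constructor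
        · rintro ⟨⟨_, hC⟩, h⟩
          exact (eq_of_subset_of_card_le h (by rw [card_insert_of_notMem heA]; omega)).symm
        · rintro rfl
          exact ⟨⟨insert_subset heE hA, by rw [card_insert_of_notMem heA, h1]⟩, Subset.rfl⟩
      rw [this, sum_singleton]
    · refine sum_eq_zero fun e he => ?_
      obtain ⟨heE, heA⟩ := mem_sdiff.1 he
      have hc := card_insert_of_notMem heA
      exact ih _ (insert_subset heE hA) (by omega) (by omega) (by omega)

theorem sum_filter_subset_disjoint_eq_zero {F ι : Type*} [Field F] [DecidableEq ι] (p : ℕ)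
    [CharP F p] (g : Finset ι → F) (E : Finset ι) (d : ℕ)
    (hg : ∀ A ⊆ E, #A + 1 = d → ∑ e ∈ E \ A, g (insert e A) = 0)
    (A R : Finset ι) (hA : A ⊆ E) (hR : R ⊆ E) (hAd : #A + #R < d) (hAp : d < #A + p) :
    ∑ C ∈ powersetCard d E with A ⊆ C ∧ Disjoint C R, g C = 0 := by
  induction R using Finset.induction_on generalizing A with
  | empty => simpa using sum_filter_subset_eq_zero p g E d hg A hA (by simpa using hAd) hAp
  | insert r R hr ih =>
    rw [card_insert_of_notMem hr] at hAd
    have hRE := (subset_insert r R).trans hR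
    have hc1 := card_insert_le r A
    have hc2 := card_le_card (subset_insert r A)
    have h1 := ih A hA hRE (by omega) hAp
    have h2 := ih (insert r A) (insert_subset (hR (mem_insert_self r R)) hA) hRE
      (by omega) (by omega)
    rw [← sum_filter_add_sum_filter_not _ (fun C => r ∈ C), filter_filter, filter_filter] at h1
    suffices h : (∑ C ∈ powersetCard d E with insert r A ⊆ C ∧ Disjoint C R, g C) +
        ∑ C ∈ powersetCard d E with A ⊆ C ∧ Disjoint C (insert r R), g C = 0 by
      rwa [h2, zero_add] at h
    rw [← h1]
    congr 1
    · refine sum_congr (filter_congr fun C _ => ?_) fun _ _ => rfl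
      simp only [insert_subset_iff]; tauto
    · refine sum_congr (filter_congr fun C _ => ?_) fun _ _ => rfl
      simp only [disjoint_insert_right]; tauto

theorem sum_mul_prod_indicator_sub_eq_zero {F ι : Type*} [Field F] [DecidableEq ι] (p : ℕ)
    [CharP F p] (g : Finset ι → F) (E : Finset ι) (d : ℕ)
    (hg : ∀ A ⊆ E, #A + 1 = d → ∑ e ∈ E \ A, g (insert e A) = 0)
    {m : ℕ} (a b : Fin m → ι) (hab : Function.Injective (Sum.elim a b))
    (ha : ∀ i, a i ∈ E) (hb : ∀ i, b i ∈ E)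
    (R : Finset ι) (hR : R ⊆ E) (hAd : m + #R < d) (hAp : d < m + p) :
    ∑ C ∈ powersetCard d E with Disjoint C R,
      g C * ∏ i, ((if a i ∈ C then 1 else 0) - (if b i ∈ C then 1 else 0)) = 0 := by
  set c : Fin m → Bool → ι := fun i j => if j then a i else b i with hc
  have hprod : ∀ C : Finset ι,
      ∏ i, ((if a i ∈ C then (1 : F) else 0) - (if b i ∈ C then 1 else 0)) =
      ∑ τ : Fin m → Bool, (∏ i, if τ i then (1 : F) else -1) *
        if univ.image (fun i => c i (τ i)) ⊆ C then 1 else 0 := by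
    intro C
    have : ∀ i, ((if a i ∈ C then (1 : F) else 0) - (if b i ∈ C then 1 else 0)) =
        ∑ j : Bool, (if j then (1 : F) else -1) * if c i j ∈ C then 1 else 0 := by
      intro i; simp only [hc, Fintype.sum_bool]; split_ifs <;> simp_all
    simp_rw [this]
    rw [prod_univ_sum]
    simp only [Fintype.piFinset_univ, prod_mul_distrib]
    refine sum_congr rfl fun τ _ => ?_
    congr 1
    rw [prod_ite_zero]
    simp [image_subset_iff]
  simp_rw [hprod, mul_sum]
  rw [sum_comm]
  refine sum_eq_zero fun τ _ => ?_
  have hinj : Function.Injective fun i => c i (τ i) := by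
    intro i j hij
    have := @hab (if τ i then Sum.inl i else Sum.inr i) (if τ j then Sum.inl j else Sum.inr j)
      (by revert hij; simp only [hc]; cases τ i <;> cases τ j <;> simp)
    revert this
    cases τ i <;> cases τ j <;> simp
  have hcard : #(univ.image fun i => c i (τ i)) = m := by
    rw [card_image_of_injective _ hinj, card_univ, Fintype.card_fin]
  have h := sum_filter_subset_disjoint_eq_zero p g E d hg (univ.image fun i => c i (τ i)) R
    (by
      rw [image_subset_iff]
      intro i _
      simp only [hc]
      split_ifs
      exacts [ha i, hb i]) hR (by omega) (by omega)
  have : ∀ C, g C * ((∏ i, if τ i then (1 : F) else -1) *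
        if univ.image (fun i => c i (τ i)) ⊆ C then 1 else 0) =
      (∏ i, if τ i then (1 : F) else -1) *
        if univ.image (fun i => c i (τ i)) ⊆ C then g C else 0 := by
    intro C; split_ifs <;> ring
  simp_rw [this]
  rw [← mul_sum, ← sum_filter, filter_filter]
  simp_rw [and_comm] at h ⊢
  rw [h, mul_zero]

theorem sum_mul_prod_eq_zero_of_span {F V ι κ : Type*} [Field F] [AddCommGroup V] [Module F V]
    [DecidableEq ι] (K : Finset κ) (ℓ : κ → V →ₗ[F] F) (β : κ → F) (v : ι → V) (T : Finset ι)
    (m : ℕ)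
    (hspan : ∀ U ⊆ T, #U < m → ∀ w, ∃ c : ι → F, ∀ C ∈ K,
      ℓ C w = ∑ t ∈ T \ U, c t * ℓ C (v t))
    (hzero : ∀ U ⊆ T, #U = m → ∑ C ∈ K, β C * ∏ u ∈ U, ℓ C (v u) = 0)
    (W : List V) (U : Finset ι) (hU : U ⊆ T) (hW : #U + W.length = m) :
    ∑ C ∈ K, β C * (∏ u ∈ U, ℓ C (v u)) * (W.map (ℓ C)).prod = 0 := by
  induction W generalizing U with
  | nil => simpa using hzero U hU (by simpa using hW)
  | cons w W ih =>
    rw [List.length_cons] at hW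
    obtain ⟨c, hc⟩ := hspan U hU (by omega) w
    have : ∀ C ∈ K, β C * (∏ u ∈ U, ℓ C (v u)) * ((w :: W).map (ℓ C)).prod =
        ∑ t ∈ T \ U, c t *
          (β C * (∏ u ∈ insert t U, ℓ C (v u)) * (W.map (ℓ C)).prod) := by
      intro C hC
      rw [List.map_cons, List.prod_cons, hc C hC, sum_mul, mul_sum]
      refine sum_congr rfl fun t ht => ?_
      rw [prod_insert (mem_sdiff.1 ht).2]
      ring
    rw [sum_congr rfl this, sum_comm]
    refine sum_eq_zero fun t ht => ?_
    obtain ⟨htT, htU⟩ := mem_sdiff.1 ht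
    rw [← mul_sum, ih _ (insert_subset htT hU) (by rw [card_insert_of_notMem htU]; omega),
      mul_zero]

/-- The linear functional obtained by fixing all but the first argument of an alternating form. -/
def AlternatingMap.consFunctional {F V : Type*} [Field F] [AddCommGroup V] [Module F V] {d : ℕ}
    (Δ : V [⋀^Fin (d + 1)]→ₗ[F] F) (x : Fin d → V) : V →ₗ[F] F where
  toFun w := Δ.curryLeft w x
  map_add' := by simp
  map_smul' := by simp

theorem AlternatingMap.consFunctional_apply {F V : Type*} [Field F] [AddCommGroup V] [Module F V]
    {d : ℕ} (Δ : V [⋀^Fin (d + 1)]→ₗ[F] F) (x : Fin d → V) (w : V) :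
    Δ.consFunctional x w = Δ (Matrix.vecCons w x) := rfl

theorem AlternatingMap.consFunctional_swap {F V : Type*} [Field F] [AddCommGroup V] [Module F V]
    {n : ℕ} (Δ : V [⋀^Fin (n + 1 + 1)]→ₗ[F] F) (x : Fin n → V) (y z : V) :
    Δ.consFunctional (Matrix.vecCons y x) z = -Δ.consFunctional (Matrix.vecCons z x) y := by
  have h := Δ.map_swap (Matrix.vecCons y (Matrix.vecCons z x)) (i := 0) (j := 1) (by simp)
  rw [consFunctional_apply, consFunctional_apply, ← h]
  congr 1
  ext i
  refine Fin.cases ?_ (fun i => ?_) i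
  · simp
  · refine Fin.cases ?_ (fun i => ?_) i
    · simp
    · rw [Function.comp_apply, Equiv.swap_apply_of_ne_of_ne]
      · simp
      · simp [Fin.ext_iff]
      · simp [Fin.ext_iff]

theorem AlternatingMap.plucker_of_ne_zero {F V : Type*} [Field F] [AddCommGroup V] [Module F V]
    {n : ℕ} (hV : Module.finrank F V = n + 1 + 1) (Δ : V [⋀^Fin (n + 1 + 1)]→ₗ[F] F)
    (x : Fin n → V) (a b c d : V) (hcd : Δ.consFunctional (Matrix.vecCons d x) c ≠ 0) :
    Δ.consFunctional (Matrix.vecCons b x) a * Δ.consFunctional (Matrix.vecCons d x) c -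
      Δ.consFunctional (Matrix.vecCons c x) a * Δ.consFunctional (Matrix.vecCons d x) b +
      Δ.consFunctional (Matrix.vecCons d x) a * Δ.consFunctional (Matrix.vecCons c x) b = 0 := by
  have hli : LinearIndependent F (Matrix.vecCons c (Matrix.vecCons d x)) := by
    by_contra h
    exact hcd (Δ.map_linearDependent _ h)
  have hdec : ∀ a, ∃ s t : F, ∀ y, Δ.consFunctional (Matrix.vecCons y x) a =
      s * Δ.consFunctional (Matrix.vecCons y x) c +
      t * Δ.consFunctional (Matrix.vecCons y x) d := by
    intro a
    have := (basisOfLinearIndependentOfCardEqFinrank hli (by simp [hV])).sum_repr a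
    rw [coe_basisOfLinearIndependentOfCardEqFinrank, Fin.sum_univ_succ, Fin.sum_univ_succ] at this
    refine ⟨(basisOfLinearIndependentOfCardEqFinrank hli (by simp [hV])).repr a 0,
      (basisOfLinearIndependentOfCardEqFinrank hli (by simp [hV])).repr a (Fin.succ 0),
      fun y => ?_⟩
    · conv_lhs => rw [← this]
      simp only [map_add, map_smul, map_sum, Matrix.cons_val_zero, Matrix.cons_val_succ,
        smul_eq_mul]
      rw [sum_eq_zero (s := univ), add_zero]
      intro i _
      have h0 : Δ.consFunctional (Matrix.vecCons y x) (x i) = 0 :=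
        Δ.map_eq_zero_of_eq _ (i := 0) (j := i.succ.succ) (by simp) (by simp [Fin.ext_iff])
      rw [h0, mul_zero]
  obtain ⟨s, t, ha⟩ := hdec a
  obtain ⟨s', t', hb⟩ := hdec b
  have hcc : Δ.consFunctional (Matrix.vecCons c x) c = 0 :=
    Δ.map_eq_zero_of_eq _ (i := 0) (j := 1) (by simp) (by simp)
  have hdd : Δ.consFunctional (Matrix.vecCons d x) d = 0 :=
    Δ.map_eq_zero_of_eq _ (i := 0) (j := 1) (by simp) (by simp)
  have h1 := Δ.consFunctional_swap x c d
  have h2 := Δ.consFunctional_swap x b c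
  have h3 := Δ.consFunctional_swap x b d
  rw [hb] at h2 h3
  simp only [ha, hb, h2, h3, hcc, hdd, h1]
  ring

/-- The linear functional, determined up to sign, whose kernel is the hyperplane spanned by the
vectors `v c` for `c ∈ C`. -/
noncomputable def hyperplaneFunctional {F V ι : Type*} [Field F] [AddCommGroup V] [Module F V]
    [LinearOrder ι] {d : ℕ} (Δ : V [⋀^Fin (d + 1)]→ₗ[F] F) (v : ι → V) (C : Finset ι) :
    V →ₗ[F] F :=
  if h : #C = d then Δ.consFunctional (v ∘ C.orderEmbOfFin h) else 0

section Arc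

variable {F V ι : Type*} [Field F] [AddCommGroup V] [Module F V] [LinearOrder ι] {d : ℕ}
  (Δ : V [⋀^Fin (d + 1)]→ₗ[F] F) (v : ι → V)

theorem comp_vecCons {α β : Type*} {n : ℕ} (g : α → β) (x : α) (f : Fin n → α) :
    g ∘ Matrix.vecCons x f = Matrix.vecCons (g x) (g ∘ f) :=
  Fin.comp_cons g x f

theorem vecCons_injective {α : Type*} {n : ℕ} {x : α} {f : Fin n → α}
    (hf : Function.Injective f) (hx : ∀ i, f i ≠ x) : Function.Injective (Matrix.vecCons x f) := by
  refine Fin.cons_injective_iff.2 ⟨?_, hf⟩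
  rintro ⟨i, hi⟩
  exact hx i hi

theorem hyperplaneFunctional_eq_zero {C : Finset ι} {s : ι} (hs : s ∈ C) :
    hyperplaneFunctional Δ v C (v s) = 0 := by
  unfold hyperplaneFunctional
  split_ifs with h
  · obtain ⟨i, hi⟩ : s ∈ Set.range (C.orderEmbOfFin h) := by simpa using hs
    exact Δ.map_eq_zero_of_eq _ (i := 0) (j := i.succ) (by simp [hi]) (by simp [Fin.ext_iff])
  · simp

theorem hyperplaneFunctional_ne_zero
    (hΔ : ∀ f : Fin (d + 1) → ι, Function.Injective f → Δ (v ∘ f) ≠ 0)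
    {C : Finset ι} (hC : #C = d) {s : ι} (hs : s ∉ C) :
    hyperplaneFunctional Δ v C (v s) ≠ 0 := by
  unfold hyperplaneFunctional
  rw [dif_pos hC, AlternatingMap.consFunctional_apply]
  have := hΔ (Matrix.vecCons s (C.orderEmbOfFin hC))
    (vecCons_injective (C.orderEmbOfFin hC).injective fun i h =>
      hs (h ▸ C.orderEmbOfFin_mem hC i))
  rwa [comp_vecCons] at this

theorem exists_perm_comp_eq {α : Type*} {n : ℕ} {f k : Fin n → α} (hf : Function.Injective f)
    (hk : Function.Injective k) (h : Set.range f = Set.range k) :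
    ∃ σ : Equiv.Perm (Fin n), f = k ∘ σ := by
  refine ⟨(Equiv.ofInjective f hf).trans
    ((Equiv.setCongr h).trans (Equiv.ofInjective k hk).symm), ?_⟩
  ext i
  simp [Equiv.apply_ofInjective_symm]

theorem exists_sign_hyperplaneFunctional_insert {n : ℕ} (Δ : V [⋀^Fin (n + 1 + 1)]→ₗ[F] F)
    {A : Finset ι} (hA : #A = n) {e : ι} (he : e ∉ A) :
    ∃ ε : F, ε ^ 2 = 1 ∧ ∀ w, hyperplaneFunctional Δ v (insert e A) w =
      ε * Δ.consFunctional (Matrix.vecCons (v e) (v ∘ A.orderEmbOfFin hA)) w := by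
  have hC : #(insert e A) = n + 1 := by rw [card_insert_of_notMem he, hA]
  obtain ⟨σ, hσ⟩ := exists_perm_comp_eq ((insert e A).orderEmbOfFin hC).injective
    (vecCons_injective (A.orderEmbOfFin hA).injective
      (fun i (h : _ = e) => he (h ▸ A.orderEmbOfFin_mem hA i)))
    (by rw [Matrix.range_cons]; simp)
  refine ⟨((Equiv.Perm.sign σ : ℤ) : F), ?_, fun w => ?_⟩
  · rcases Int.units_eq_one_or (Equiv.Perm.sign σ) with h | h <;> simp [h]
  · unfold hyperplaneFunctional
    rw [dif_pos hC, hσ, ← comp_vecCons, ← Function.comp_assoc]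
    change (Δ.curryLeft w) _ = _ * (Δ.curryLeft w) _
    rw [AlternatingMap.map_perm, Units.smul_def, zsmul_eq_mul]

theorem exists_eq_sum_smul_of_card (hV : Module.finrank F V = d + 1)
    (hΔ : ∀ f : Fin (d + 1) → ι, Function.Injective f → Δ (v ∘ f) ≠ 0)
    {X : Finset ι} (hX : d + 1 ≤ #X) (w : V) : ∃ c : ι → F, w = ∑ x ∈ X, c x • v x := by
  obtain ⟨Y, hYX, hY⟩ := exists_subset_card_eq hX
  have hli : LinearIndependent F (v ∘ Y.orderEmbOfFin hY) := by
    by_contra h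
    exact hΔ _ (Y.orderEmbOfFin hY).injective (Δ.map_linearDependent _ h)
  have hspan := hli.span_eq_top_of_card_eq_finrank (by simp [hV])
  have hw : w ∈ Submodule.span F (v '' (X : Set ι)) := by
    have : w ∈ Submodule.span F (Set.range (v ∘ Y.orderEmbOfFin hY)) := hspan ▸ Submodule.mem_top
    refine Submodule.span_mono ?_ this
    rw [Set.range_comp]
    simpa using Set.image_mono (f := v) (by exact_mod_cast hYX : (Y : Set ι) ⊆ X)
  obtain ⟨c, hc⟩ := (Submodule.mem_span_image_finset_iff_exists_fun' (R := F)).1 hw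
  exact ⟨c, hc.symm⟩

end Arc

/-- The weight attached to a hyperplane spanned by `C ⊆ E`; these weights satisfy the linear
relations `sum_arcWeight_insert_eq_zero`. -/
noncomputable def arcWeight {F V ι : Type*} [Field F] [AddCommGroup V] [Module F V] [Fintype ι]
    [LinearOrder ι] {d : ℕ} (Δ : V [⋀^Fin (d + 1)]→ₗ[F] F) (v : ι → V) (E C : Finset ι) : F :=
  (∏ s ∈ univ \ C, hyperplaneFunctional Δ v C (v s))⁻¹ *
    (∏ u ∈ E \ C, hyperplaneFunctional Δ v C (v u))⁻¹

theorem sum_arcWeight_insert_eq_zero {F V ι : Type*} [Field F] [Fintype F] [AddCommGroup V]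
    [Module F V] [Fintype ι] [LinearOrder ι] {n : ℕ} (hn : 1 ≤ n)
    (Δ : V [⋀^Fin (n + 1 + 1)]→ₗ[F] F) (v : ι → V) (hV : Module.finrank F V = n + 1 + 1)
    (hΔ : ∀ f : Fin (n + 1 + 1) → ι, Function.Injective f → Δ (v ∘ f) ≠ 0)
    (hι : Fintype.card ι = Fintype.card F + 2) (hodd : Odd (Fintype.card F))
    {E A : Finset ι} (hE : #E = 2 * n + 1) {s₀ : ι} (hs₀ : s₀ ∉ E) (hAE : A ⊆ E) (hA : #A = n) :
    ∑ e ∈ E \ A, arcWeight Δ v E (insert e A) = 0 := by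
  classical
  set β : ι → ι → F := fun s e =>
    Δ.consFunctional (Matrix.vecCons (v e) (v ∘ A.orderEmbOfFin hA)) (v s) with hβ
  have hcE : #(E \ A) = n + 1 := by rw [card_sdiff_of_subset hAE]; omega
  have hcN : #(univ \ A) + n = Fintype.card F + 2 := by
    have := card_le_univ A
    rw [card_sdiff_of_subset (subset_univ _), card_univ]; omega
  rw [← sum_mul_prod_bracket_inv_eq_zero β (univ \ A) (E \ A) s₀
    (by simpa using fun h => hs₀ (hAE h)) ?_ (by omega) (by omega) ?_ (fun s e => Δ.consFunctional_swap _ _ _)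
    (fun a b c d h => Δ.plucker_of_ne_zero hV _ _ _ _ _ h)]
  · refine sum_congr rfl fun e he => ?_
    obtain ⟨heE, heA⟩ := mem_sdiff.1 he
    obtain ⟨ε, hε, hℓ⟩ := exists_sign_hyperplaneFunctional_insert v Δ hA heA
    unfold arcWeight
    have h1 : univ \ insert e A = (univ \ A).erase e := sdiff_insert _ _ _
    have h2 : E \ insert e A = (E \ A).erase e := sdiff_insert _ _ _
    rw [h1, h2, ← mul_inv, ← mul_inv]
    simp_rw [hℓ]
    rw [prod_mul_distrib, prod_mul_distrib, prod_const, prod_const,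
      card_erase_of_mem (by simpa using heA), card_erase_of_mem he, mul_mul_mul_comm, ← pow_add]
    obtain ⟨r, hr⟩ := hodd
    have hnr : n + 1 ≤ #(univ \ A) :=
      hcE ▸ card_le_card (sdiff_subset_sdiff (subset_univ _) Subset.rfl)
    rw [show #(univ \ A) - 1 + (#(E \ A) - 1) = 2 * (r + 1) by omega, pow_mul, hε, one_pow, one_mul]
  · intro s hs
    obtain ⟨h1, h2⟩ := mem_sdiff.1 hs
    simp only [mem_erase, mem_sdiff, mem_univ, true_and]
    exact ⟨fun h => hs₀ (h ▸ h1), h2⟩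
  · intro s hs e he hse
    have heA := (mem_sdiff.1 he).2
    have hsA := (mem_sdiff.1 hs).2
    obtain ⟨ε, -, hℓ⟩ := exists_sign_hyperplaneFunctional_insert v Δ hA heA
    have := hyperplaneFunctional_ne_zero Δ v hΔ (C := insert e A)
      (by rw [card_insert_of_notMem heA, hA]) (s := s) (by simp [hse, hsA])
    rw [hℓ] at this
    exact right_ne_zero_of_mul this

theorem card_inter_image_union_image_le {ι : Type*} [DecidableEq ι] {m : ℕ} (a b : Fin m → ι)
    (C : Finset ι) (h : ∀ i, ¬(a i ∈ C ∧ b i ∈ C)) :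
    #(C ∩ (univ.image a ∪ univ.image b)) ≤ m := by
  calc #(C ∩ (univ.image a ∪ univ.image b))
      ≤ #(univ.image fun i => if a i ∈ C then a i else b i) := by
        refine card_le_card fun x hx => ?_
        simp only [mem_inter, mem_union, mem_image, mem_univ, true_and] at hx ⊢
        obtain ⟨hxC, ⟨i, rfl⟩ | ⟨i, rfl⟩⟩ := hx
        · exact ⟨i, if_pos hxC⟩
        · exact ⟨i, if_neg fun ha => h i ⟨ha, hxC⟩⟩
    _ ≤ m := card_image_le.trans (by simp)

theorem exists_disjoint_configuration {ι : Type*} [Fintype ι] [DecidableEq ι] (m x y : ℕ)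
    (h : x + 2 * m + y + 1 ≤ Fintype.card ι) :
    ∃ (a b : Fin m → ι) (B T : Finset ι) (s₀ : ι), Function.Injective (Sum.elim a b) ∧
      #B = x ∧ #T = y ∧ Disjoint B (univ.image a ∪ univ.image b) ∧
      Disjoint (B ∪ (univ.image a ∪ univ.image b)) T ∧
      s₀ ∉ B ∪ (univ.image a ∪ univ.image b) ∧ s₀ ∉ T := by
  obtain ⟨φ⟩ : Nonempty (((Fin m ⊕ Fin m) ⊕ Fin x) ⊕ (Fin y ⊕ Unit) ↪ ι) :=
    Function.Embedding.nonempty_of_card_le (by simp; omega)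
  have hφ := φ.injective
  refine ⟨fun i => φ (.inl (.inl (.inl i))), fun i => φ (.inl (.inl (.inr i))),
    univ.image fun i => φ (.inl (.inr i)), univ.image fun i => φ (.inr (.inl i)),
    φ (.inr (.inr ())), ?_, ?_, ?_, ?_, ?_, ?_, ?_⟩
  · rintro (i | i) (j | j) h <;> simp only [Sum.elim_inl, Sum.elim_inr] at h <;>
      simpa using hφ h
  · rw [card_image_of_injective _ fun i j h => by simpa using h, card_univ, Fintype.card_fin]
  · rw [card_image_of_injective _ fun i j h => by simpa using h, card_univ, Fintype.card_fin]
  · simp [disjoint_left]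
  · rw [disjoint_left]
    simp only [mem_union, mem_image, mem_univ, true_and]
    rintro _ (⟨i, rfl⟩ | ⟨i, rfl⟩ | ⟨i, rfl⟩) <;> simp
  · simp
  · simp

theorem not_forall_alternating_ne_zero {F V ι : Type*} [Field F] [Fintype F] [AddCommGroup V]
    [Module F V] [Fintype ι] [LinearOrder ι] {d : ℕ} (hd : 2 ≤ d) (p : ℕ) [CharP F p]
    (hdp : d + 3 ≤ 2 * p) (hq : p ^ 2 ≤ Fintype.card F) (hodd : Odd (Fintype.card F))
    (Δ : V [⋀^Fin (d + 1)]→ₗ[F] F) (v : ι → V) (hV : Module.finrank F V = d + 1)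
    (hι : Fintype.card ι = Fintype.card F + 2) :
    ¬ ∀ f : Fin (d + 1) → ι, Function.Injective f → Δ (v ∘ f) ≠ 0 := by
  classical
  intro hΔ
  have hp : 0 < p := by omega
  set m := d + 1 - p with hm
  obtain ⟨a, b, B, T, s₀, hab, hB, hT, hBP, hQT, hs₀Q, hs₀T⟩ :=
    exists_disjoint_configuration (ι := ι) m (d - m) (d - 1) (by
      rw [hι]
      have : 5 * p ≤ p ^ 2 + 10 := by
        obtain h | h := le_or_gt p 2
        · omega
        · obtain ⟨r, rfl⟩ := Nat.exists_eq_add_of_lt h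
          nlinarith [Nat.le_self_pow (n := 2) (by norm_num) r]
      omega)
  set P := univ.image a ∪ univ.image b with hP
  set Q := B ∪ P with hQ
  have ha_inj : Function.Injective a := fun i j h => by simpa using @hab (.inl i) (.inl j) h
  have hb_inj : Function.Injective b := fun i j h => by simpa using @hab (.inr i) (.inr j) h
  have hne : ∀ i j, a i ≠ b j := fun i j h => by simpa using @hab (.inl i) (.inr j) h
  have hPcard : #P = 2 * m := by
    rw [hP, card_union_of_disjoint (by
      rw [disjoint_left]
      simp only [mem_image, mem_univ, true_and]
      rintro _ ⟨i, rfl⟩ ⟨j, h⟩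
      exact hne i j h.symm), card_image_of_injective _ ha_inj, card_image_of_injective _ hb_inj]
    simp; omega
  have hmd : m ≤ d := by omega
  have hQcard : #Q = d + m := by rw [hQ, card_union_of_disjoint hBP, hB, hPcard]; omega
  have haP : ∀ i, a i ∈ P := fun i => mem_union_left _ (mem_image_of_mem _ (mem_univ i))
  have hbP : ∀ i, b i ∈ P := fun i => mem_union_right _ (mem_image_of_mem _ (mem_univ i))
  have haQ : ∀ i, a i ∈ Q := fun i => mem_union_right _ (haP i)
  have hbQ : ∀ i, b i ∈ Q := fun i => mem_union_right _ (hbP i)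
  set ε : Finset ι → F := fun C =>
    ∏ i, ((if a i ∈ C then 1 else 0) - (if b i ∈ C then 1 else 0)) with hε
  have hε_ne : ∀ C, ε C ≠ 0 → ∀ i, ¬(a i ∈ C ∧ b i ∈ C) ∧ (b i ∉ C → a i ∈ C) := by
    intro C h i
    have hi := prod_ne_zero_iff.1 h i (mem_univ i)
    by_cases h1 : a i ∈ C <;> by_cases h2 : b i ∈ C <;> simp_all
  set ℓ := hyperplaneFunctional Δ v with hℓ
  set K := {C ∈ powersetCard d Q | ε C ≠ 0} with hK
  have hBK : ∀ C ∈ K, B ⊆ C := by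
    intro C hC
    obtain ⟨hC, hεC⟩ := mem_filter.1 hC
    obtain ⟨hCQ, hCd⟩ := mem_powersetCard.1 hC
    have h1 := card_inter_image_union_image_le a b C fun i => (hε_ne C hεC i).1
    have h2 := card_sdiff_add_card_inter C P
    have h3 : C \ P ⊆ B := fun x hx =>
      (mem_union.1 (hCQ (mem_sdiff.1 hx).1)).resolve_right (mem_sdiff.1 hx).2
    rw [← hP] at h1
    rw [← eq_of_subset_of_card_le h3 (by rw [hB]; omega)]
    exact sdiff_subset
  set β : Finset ι → F := fun C => ε C * (∏ s ∈ univ \ C, ℓ C (v s))⁻¹ *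
    (∏ u ∈ Q \ C, ℓ C (v u))⁻¹ * (∏ t ∈ T, ℓ C (v t))⁻¹ with hβ
  have hzero : ∀ U ⊆ T, #U = m → ∑ C ∈ K, β C * ∏ u ∈ U, ℓ C (v u) = 0 := by
    intro U hUT hU
    have hQR : Disjoint Q (T \ U) := hQT.mono_right sdiff_subset
    have hR : #(T \ U) = d - 1 - m := by rw [card_sdiff_of_subset hUT]; omega
    have hg : ∀ A ⊆ Q ∪ T \ U, #A + 1 = d →
        ∑ e ∈ (Q ∪ T \ U) \ A, arcWeight Δ v (Q ∪ T \ U) (insert e A) = 0 := by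
      intro A hA hAd
      obtain ⟨n, rfl⟩ : ∃ n, d = n + 1 := ⟨d - 1, by omega⟩
      refine sum_arcWeight_insert_eq_zero (by omega) Δ v hV hΔ hι hodd ?_ (s₀ := s₀) ?_ hA
        (by omega)
      · rw [card_union_of_disjoint hQR, hQcard, hR]; omega
      · rw [mem_union, mem_sdiff]; tauto
    have h := sum_mul_prod_indicator_sub_eq_zero p _ _ d hg a b hab
      (fun i => mem_union_left _ (haQ i)) (fun i => mem_union_left _ (hbQ i)) (T \ U)
      subset_union_right (by omega) (by omega)
    have hset : {C ∈ powersetCard d (Q ∪ T \ U) | Disjoint C (T \ U)} = powersetCard d Q := by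
      ext C
      simp only [mem_filter, mem_powersetCard]
      constructor
      · rintro ⟨⟨h1, h2⟩, h3⟩
        exact ⟨h3.left_le_of_le_sup_right h1, h2⟩
      · rintro ⟨h1, h2⟩
        exact ⟨⟨h1.trans subset_union_left, h2⟩, hQR.mono_left h1⟩
    rw [hset] at h
    rw [← h, hK, sum_filter]
    refine sum_congr rfl fun C hC => ?_
    obtain ⟨hCQ, hCd⟩ := mem_powersetCard.1 hC
    change _ = _ * ε C
    split_ifs with hεC
    · have hU0 : ∏ u ∈ U, ℓ C (v u) ≠ 0 := prod_ne_zero_iff.2 fun u hu =>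
        hyperplaneFunctional_ne_zero Δ v hΔ hCd fun huC =>
          disjoint_left.1 hQT (hCQ huC) (hUT hu)
      have h1 : (Q ∪ T \ U) \ C = Q \ C ∪ T \ U := by
        rw [union_sdiff_distrib, sdiff_eq_self_of_disjoint (hQR.mono_left hCQ).symm]
      simp only [hβ, arcWeight]
      rw [h1, prod_union (hQR.mono_left sdiff_subset), ← prod_sdiff hUT, ← hℓ]
      simp only [mul_inv]
      linear_combination ε C * (∏ s ∈ univ \ C, ℓ C (v s))⁻¹ * (∏ u ∈ Q \ C, ℓ C (v u))⁻¹ *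
        (∏ t ∈ T \ U, ℓ C (v t))⁻¹ * inv_mul_cancel₀ hU0
    · rw [not_not.1 hεC, mul_zero]
  have hspan : ∀ U ⊆ T, #U < m → ∀ w, ∃ c : ι → F, ∀ C ∈ K,
      ℓ C w = ∑ t ∈ T \ U, c t * ℓ C (v t) := by
    intro U hUT hU w
    have hBT : Disjoint B (T \ U) := hQT.mono subset_union_left sdiff_subset
    obtain ⟨c, hc⟩ := exists_eq_sum_smul_of_card Δ v hV hΔ (X := B ∪ T \ U) (by
      have := card_sdiff_of_subset hUT
      rw [card_union_of_disjoint hBT]; omega) w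
    refine ⟨c, fun C hC => ?_⟩
    rw [hc, map_sum, sum_union hBT, sum_eq_zero (s := B), zero_add]
    · simp
    · intro x hx
      rw [map_smul, hℓ, hyperplaneFunctional_eq_zero Δ v (hBK C hC hx), smul_zero]
  have hfinal := sum_mul_prod_eq_zero_of_span K ℓ β v T m hspan hzero
    (List.ofFn fun i => v (b i)) ∅ (empty_subset _) (by simp)
  simp only [prod_empty, mul_one, List.map_ofFn, List.prod_ofFn, Function.comp_apply] at hfinal
  set C₀ := B ∪ univ.image a with hC₀
  have hC₀card : #C₀ = d := by
    rw [hC₀, card_union_of_disjoint (hBP.mono_right subset_union_left), hB,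
      card_image_of_injective _ ha_inj]
    simp; omega
  have hC₀Q : C₀ ⊆ Q := union_subset_union_right subset_union_left
  have hbC₀ : ∀ i, b i ∉ C₀ := by
    intro i hi
    rcases mem_union.1 hi with hi | hi
    · exact disjoint_left.1 hBP hi (hbP i)
    · obtain ⟨j, -, hj⟩ := mem_image.1 hi
      exact hne j i hj
  have haC₀ : ∀ i, a i ∈ C₀ := fun i => mem_union_right _ (mem_image_of_mem _ (mem_univ i))
  have hεC₀ : ε C₀ = 1 := by simp [hε, hbC₀, haC₀]
  have hC₀K : C₀ ∈ K := by simp [hK, hC₀Q, hC₀card, hεC₀]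
  have hℓ₀ : ∀ s ∉ C₀, ℓ C₀ (v s) ≠ 0 := fun s hs =>
    hyperplaneFunctional_ne_zero Δ v hΔ hC₀card hs
  rw [sum_eq_single_of_mem C₀ hC₀K] at hfinal
  · refine mul_ne_zero (mul_ne_zero (mul_ne_zero (mul_ne_zero ?_ ?_) ?_) ?_) ?_ hfinal
    · rw [hεC₀]; exact one_ne_zero
    · exact inv_ne_zero (prod_ne_zero_iff.2 fun s hs => hℓ₀ s (mem_sdiff.1 hs).2)
    · exact inv_ne_zero (prod_ne_zero_iff.2 fun s hs => hℓ₀ s (mem_sdiff.1 hs).2)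
    · exact inv_ne_zero (prod_ne_zero_iff.2 fun s hs => hℓ₀ s fun h =>
        disjoint_left.1 hQT (hC₀Q h) hs)
    · exact prod_ne_zero_iff.2 fun i _ => hℓ₀ _ (hbC₀ i)
  · intro C hC hCC₀
    obtain ⟨i, hi⟩ : ∃ i, b i ∈ C := by
      by_contra! hbC
      obtain ⟨hC', hεC⟩ := mem_filter.1 hC
      have hsub : C₀ ⊆ C := union_subset (hBK C hC)
        (image_subset_iff.2 fun i _ => (hε_ne C hεC i).2 (hbC i))
      exact hCC₀ (eq_of_subset_of_card_le hsub
        (by rw [hC₀card, (mem_powersetCard.1 hC').2])).symm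
    rw [prod_eq_zero (mem_univ i) (hyperplaneFunctional_eq_zero Δ v hi), mul_zero]

theorem exists_dual_configuration {F : Type*} [Field F] {k l : ℕ} (u : Fin (k + l) → Fin k → F)
    (hu : ∀ f : Fin k → Fin (k + l), Function.Injective f → LinearIndependent F (u ∘ f)) :
    ∃ v : Fin (k + l) → Fin l → F, ∀ f : Fin l → Fin (k + l), Function.Injective f →
      Matrix.detRowAlternating (v ∘ f) ≠ 0 := by
  classical
  have hker : l ≤ Module.finrank F (LinearMap.ker (Fintype.linearCombination F u)) := by
    have h1 := (Fintype.linearCombination F u).finrank_range_add_finrank_ker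
    have h2 := (LinearMap.range (Fintype.linearCombination F u)).finrank_le
    simp only [Module.finrank_fin_fun] at h1 h2
    omega
  obtain ⟨b, hb⟩ := exists_linearIndependent_of_le_finrank hker
  refine ⟨fun i j => (b j : Fin (k + l) → F) i, fun f hf hdet => ?_⟩
  obtain ⟨x, hx0, hx⟩ := Matrix.exists_mulVec_eq_zero_iff.2
    (show (Matrix.of fun a j => (b j : Fin (k + l) → F) (f a)).det = 0 from hdet)
  apply hx0
  set w : LinearMap.ker (Fintype.linearCombination F u) := ∑ j, x j • b j with hw
  have hwf : ∀ a, (w : Fin (k + l) → F) (f a) = 0 := by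
    intro a
    have := congrFun hx a
    simp only [Matrix.mulVec, dotProduct, Matrix.of_apply, Pi.zero_apply] at this
    rw [← this, hw]
    simp [Finset.sum_apply, mul_comm]
  have hw0 : w = 0 := by
    set C : Finset (Fin (k + l)) := univ \ univ.image f with hC
    have hCcard : #C = k := by
      rw [hC, card_sdiff_of_subset (subset_univ _), card_image_of_injective _ hf]
      simp
    have hli := hu _ (C.orderEmbOfFin hCcard).injective
    rw [Fintype.linearIndependent_iff] at hli
    have hLw : Fintype.linearCombination F u (w : Fin (k + l) → F) = 0 := w.2
    rw [Fintype.linearCombination_apply] at hLw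
    have hnot : ∀ i, i ∉ C → (w : Fin (k + l) → F) i = 0 := by
      intro i hi
      obtain ⟨a, rfl⟩ : ∃ a, f a = i := by simpa [hC] using hi
      exact hwf a
    have hsum : ∑ a, (w : Fin (k + l) → F) (C.orderEmbOfFin hCcard a) •
        (u ∘ C.orderEmbOfFin hCcard) a = 0 := by
      rw [← hLw, ← sum_subset (subset_univ C) fun i _ hi => by rw [hnot i hi, zero_smul]]
      conv_rhs => rw [← image_orderEmbOfFin_univ C hCcard]
      rw [sum_image fun _ _ _ _ h => (C.orderEmbOfFin hCcard).injective h]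
      rfl
    ext i
    by_cases hi : i ∈ C
    · obtain ⟨a, rfl⟩ : i ∈ Set.range (C.orderEmbOfFin hCcard) := by simpa using hi
      exact hli _ hsum a
    · exact hnot i hi
  funext j
  exact Fintype.linearIndependent_iff.1 hb x hw0 j

theorem not_forall_detRowAlternating_two_ne_zero {F : Type*} [Field F] [Fintype F] {ι : Type*}
    [Fintype ι] [DecidableEq ι] (hι : Fintype.card F + 2 ≤ Fintype.card ι)
    (v : ι → Fin 2 → F) :
    ¬ ∀ f : Fin 2 → ι, Function.Injective f → Matrix.detRowAlternating (v ∘ f) ≠ 0 := by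
  classical
  intro hv
  have hdet : ∀ i j, i ≠ j → v i 0 * v j 1 - v i 1 * v j 0 ≠ 0 := by
    intro i j hij
    have : Matrix.det (Matrix.of (v ∘ ![i, j])) ≠ 0 := hv ![i, j] (by
      intro a b; fin_cases a <;> fin_cases b <;> simp [hij, hij.symm])
    rw [Matrix.det_fin_two] at this
    simpa using this
  obtain ⟨i, j, hij, h⟩ := Fintype.exists_ne_map_eq_of_card_lt
    (fun i => if v i 0 = 0 then (none : Option F) else some (v i 1 / v i 0)) (by simp; omega)
  refine hdet i j hij ?_
  split_ifs at h with h1 h2 h2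
  · rw [h1, h2]; ring
  · rw [Option.some_inj] at h
    field_simp at h
    linear_combination -h

/-- Let `p` be a prime, `h ≥ 2` (so `q = p^h` is not prime), and let `S` be a
finite set of vectors of `𝔽_q^k` (`k ≥ 1`) such that every subset of `S` of size `k` is a
basis of `𝔽_q^k`.  If `q − 2p + 4 ≤ k ≤ q` then `|S| ≤ q + 1`. -/
theorem statement2 (p h k : ℕ) (hp : p.Prime) (hh : 2 ≤ h) (hk : 1 ≤ k)
    (F : Type) [Field F] [Fintype F] [DecidableEq F] (hF : Fintype.card F = p ^ h)
    (S : Finset (Fin k → F))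
    (harc : ∀ A ⊆ S, A.card = k →
      LinearIndependent F (fun v : {x // x ∈ A} => (v : Fin k → F)) ∧
      Submodule.span F (A : Set (Fin k → F)) = ⊤)
    (hk1 : p ^ h + 4 ≤ k + 2 * p) (hk2 : k ≤ p ^ h) :
    S.card ≤ p ^ h + 1 := by
  by_contra! hS
  obtain ⟨l, hl⟩ : ∃ l, k + l = p ^ h + 2 := ⟨p ^ h + 2 - k, by omega⟩
  obtain ⟨u⟩ : Nonempty (Fin (k + l) ↪ S) :=
    Function.Embedding.nonempty_of_card_le (by simp; omega)
  obtain ⟨v, hv⟩ := exists_dual_configuration (fun i => (u i : Fin k → F)) (fun f hf => by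
    set g : Fin k → Fin k → F := fun i => u (f i) with hg
    have hginj : Function.Injective g := Subtype.val_injective.comp (u.injective.comp hf)
    have := (harc (univ.image g) (by
      rw [image_subset_iff]; exact fun i _ => (u (f i)).2)
      (by rw [card_image_of_injective _ hginj]; simp)).1
    exact this.comp (fun i => ⟨g i, mem_image_of_mem g (mem_univ i)⟩)
      fun i j hij => hginj (Subtype.mk.inj hij))
  have hι : Fintype.card (Fin (k + l)) = Fintype.card F + 2 := by rw [Fintype.card_fin, hl, hF]
  obtain rfl | hl2 : l = 2 ∨ 3 ≤ l := by omega
  · exact not_forall_detRowAlternating_two_ne_zero hι.ge v hv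
  · obtain ⟨d, rfl⟩ : ∃ d, l = d + 1 := ⟨l - 1, by omega⟩
    have := Fact.mk hp
    have : CharP F p := charP_of_card_eq_prime_pow hF
    have hp2 : p ≠ 2 := by omega
    exact not_forall_alternating_ne_zero (by omega) p (by omega)
      (by rw [hF]; exact Nat.pow_le_pow_right hp.pos hh)
      (by rw [hF]; exact (hp.odd_of_ne_two hp2).pow) _ v (by simp) hι hv
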